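/- For 1/2 < p < 1, let ρ_p = 1 - (p/(1-p))^{1/(1-2p)}. Then ρ_p ∈ (0,1), and the coefficients E_n = [z^{n-1}] (1-2p)/((1-p)(1-z) - p(1-z)^{2p}) satisfy E_n = (1/(1-p)) ρ_p^{-n} - (2p-1)/(1-p) + O(n^{1-2p}) as n → ∞. -/

import Mathlib

open Real Filter Topology Set Asymptotics

/-- `F` converges at `z` with sum `v`. -/
def HS (F : PowerSeries ℝ) (z v : ℝ) : Prop :=
  HasSum (fun n => PowerSeries.coeff n F * z ^ n) v

lemma HS.mul {F G : PowerSeries ℝ} {z v w : ℝ} (hF : HS F z v) (hG : HS G z w) :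
    HS (F * G) z (v * w) := by
  have key : ∀ n, PowerSeries.coeff n (F * G) * z ^ n =
      ∑ kl ∈ Finset.HasAntidiagonal.antidiagonal n, (PowerSeries.coeff kl.1 F * z ^ kl.1) *
        (PowerSeries.coeff kl.2 G * z ^ kl.2) := by
    intro n
    rw [PowerSeries.coeff_mul, Finset.sum_mul]
    refine Finset.sum_congr rfl fun kl h => ?_
    rw [← Finset.HasAntidiagonal.mem_antidiagonal.1 h, pow_add]; ring
  unfold HS at *
  have h1 : Summable fun n => ‖PowerSeries.coeff n F * z ^ n‖ := hF.summable.norm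
  have h2 : Summable fun n => ‖PowerSeries.coeff n G * z ^ n‖ := hG.summable.norm
  have h3 := (summable_norm_sum_mul_antidiagonal_of_summable_norm h1 h2).of_norm
  have h4 := tsum_mul_tsum_eq_tsum_sum_antidiagonal_of_summable_norm h1 h2
  rw [hF.tsum_eq, hG.tsum_eq] at h4
  simp_rw [key]
  rw [h4]
  exact h3.hasSum

lemma HS.sub {F G : PowerSeries ℝ} {z v w : ℝ} (hF : HS F z v) (hG : HS G z w) :
    HS (F - G) z (v - w) := by
  unfold HS at *
  simpa [sub_mul] using HasSum.sub hF hG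

lemma HS_C (c z : ℝ) : HS (PowerSeries.C c) z c := by
  unfold HS
  have := hasSum_single (f := fun n => PowerSeries.coeff n (PowerSeries.C c) * z ^ n) 0
    (by intro n hn; simp [PowerSeries.coeff_C, hn])
  simpa using this

lemma HS_one (z : ℝ) : HS 1 z 1 := by simpa using HS_C 1 z

lemma HS_X (z : ℝ) : HS PowerSeries.X z z := by
  unfold HS
  have := hasSum_single (f := fun n => PowerSeries.coeff n (PowerSeries.X : PowerSeries ℝ) * z ^ n) 1
    (by intro n hn; simp [PowerSeries.coeff_X, hn])
  simpa using this

lemma HS.unique {F : PowerSeries ℝ} {z v w : ℝ} (h : HS F z v) (h' : HS F z w) : v = w :=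
  HasSum.unique h h'

lemma HS.eq_one {F : PowerSeries ℝ} {r : ℝ} (hr : 0 < r) (h : ∀ z, |z| < r → HS F z 1) :
    F = 1 := by
  have h0 : ∀ z, |z| < r → HS (F - 1) z 0 := fun z hz => by
    simpa using (h z hz).sub (HS_one z)
  have : HasFPowerSeriesAt (fun _ : ℝ => (0:ℝ))
      (FormalMultilinearSeries.ofScalars ℝ (fun n => PowerSeries.coeff n (F - 1))) 0 := by
    rw [hasFPowerSeriesAt_iff]
    have : Metric.ball (0:ℝ) r ∈ 𝓝 (0:ℝ) := Metric.ball_mem_nhds _ hr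
    filter_upwards [this] with z hz
    have := h0 z (by simpa using hz)
    unfold HS at this
    simp only [FormalMultilinearSeries.coeff_ofScalars, smul_eq_mul]
    simpa only [mul_comm] using this
  have h1 := this.eq_zero
  rw [← sub_eq_zero]
  ext n
  have := congrArg (fun p => FormalMultilinearSeries.coeff p n) h1
  have hz : FormalMultilinearSeries.coeff (0 : FormalMultilinearSeries ℝ ℝ ℝ) n = 0 := rfl
  rw [hz, FormalMultilinearSeries.coeff_ofScalars] at this
  rw [this, map_zero]

/-- coefficients: `1 - (1-z)^α = ∑ aC α n z^(n+1)`. -/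
noncomputable def aC (α : ℝ) (n : ℕ) : ℝ := (-1) ^ n * Ring.choose α (n + 1)

lemma aC_zero (α : ℝ) : aC α 0 = α := by simp [aC]

lemma choose_rec (α : ℝ) (n : ℕ) :
    ((n:ℝ) + 1) * Ring.choose α (n + 1) = (α - n) * Ring.choose α n := by
  have := Ring.choose_smul_choose α (n := n + 1) (k := n) (by omega)
  simpa [mul_comm] using this

lemma aC_succ (α : ℝ) (n : ℕ) : ((n:ℝ) + 2) * aC α (n + 1) = (n + 1 - α) * aC α n := by
  have := choose_rec α (n + 1)
  push_cast at this
  unfold aC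
  rw [pow_succ]
  linear_combination (-1) * (-1) ^ n * this

lemma aC_pos {α : ℝ} (h0 : 0 < α) (h1 : α < 1) (n : ℕ) : 0 < aC α n := by
  induction n with
  | zero => rwa [aC_zero]
  | succ n ih =>
    have h := aC_succ α n
    have h2 : 0 < ((n:ℝ) + 1 - α) * aC α n := by
      apply mul_pos _ ih
      have : (0:ℝ) ≤ n := n.cast_nonneg
      linarith
    rw [← h] at h2
    exact pos_of_mul_pos_right h2 (by positivity)

lemma aC_sum (α : ℝ) (n : ℕ) :
    α * (1 - ∑ k ∈ Finset.range n, aC α k) = (n + 1) * aC α n := by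
  induction n with
  | zero => simp [aC_zero]
  | succ n ih =>
    rw [Finset.sum_range_succ]
    have h := aC_succ α n
    push_cast
    linear_combination ih - h

lemma aC_bound {α : ℝ} (h0 : 0 < α) (h1 : α < 1) (n : ℕ) :
    ((n:ℝ) + 1) * aC α n ≤ α * ((n:ℝ) + 1) ^ (-α) := by
  induction n with
  | zero => simp [aC_zero]
  | succ n ih =>
    have h := aC_succ α n
    have hn : (0:ℝ) ≤ n := n.cast_nonneg
    have e : ((n + 1 : ℕ):ℝ) + 1 = n + 2 := by push_cast; ring
    rw [e, h]
    -- (n+1-α)/(n+1) ≤ ((n+1)/(n+2))^α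
    have hB : 1 + (1 / ((n:ℝ) + 1)) * α ≥ (1 + 1 / ((n:ℝ) + 1)) ^ α := by
      have := rpow_one_add_le_one_add_mul_self (s := 1 / ((n:ℝ)+1)) (p := α)
        (by have : (0:ℝ) ≤ 1 / ((n:ℝ)+1) := by positivity
            linarith) h0.le h1.le
      linarith
    have e2 : (1:ℝ) + 1 / ((n:ℝ) + 1) = (n + 2) / (n + 1) := by field_simp; ring
    rw [e2, Real.div_rpow (by positivity) (by positivity)] at hB
    have hx : 0 < ((n:ℝ) + 1) ^ α := by positivity
    have hy : 0 < ((n:ℝ) + 2) ^ α := by positivity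
    rw [Real.rpow_neg (by positivity)] at ih ⊢
    have ha := aC_pos h0 h1 n
    generalize ((n:ℝ) + 1) ^ α = x at *
    generalize ((n:ℝ) + 2) ^ α = y at *
    generalize aC α n = a at *
    have ih2 : ((n:ℝ) + 1) * a * x ≤ α := by
      have := mul_le_mul_of_nonneg_right ih hx.le
      rwa [mul_assoc α, inv_mul_cancel₀ hx.ne', mul_one] at this
    rw [← div_eq_mul_inv, le_div_iff₀ hy]
    have hy2 : y ≤ (1 + 1 / ((n:ℝ)+1) * α) * x := by
      rwa [ge_iff_le, div_le_iff₀ hx] at hB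
    have hm : 0 < (n:ℝ) + 1 := by positivity
    have h3 : ((n:ℝ) + 1 - α) * (1 + 1 / ((n:ℝ)+1) * α) ≤ n + 1 := by
      rw [show ((n:ℝ) + 1 - α) * (1 + 1 / ((n:ℝ)+1) * α) = n + 1 - α ^ 2 / (n + 1) by
        field_simp; ring]
      have : 0 ≤ α ^ 2 / ((n:ℝ) + 1) := by positivity
      linarith
    calc ((n:ℝ) + 1 - α) * a * y ≤ ((n:ℝ) + 1 - α) * a * ((1 + 1 / ((n:ℝ)+1) * α) * x) := by
          apply mul_le_mul_of_nonneg_left hy2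
          apply mul_nonneg _ ha.le
          linarith
      _ = (((n:ℝ) + 1 - α) * (1 + 1 / ((n:ℝ)+1) * α)) * (a * x) := by ring
      _ ≤ (n + 1) * (a * x) := by
          apply mul_le_mul_of_nonneg_right h3; positivity
      _ ≤ α := by linarith

lemma aC_sum_bound {α : ℝ} (h0 : 0 < α) (h1 : α < 1) (n : ℕ) :
    0 ≤ 1 - ∑ k ∈ Finset.range n, aC α k ∧
    1 - ∑ k ∈ Finset.range n, aC α k ≤ ((n:ℝ) + 1) ^ (-α) := by
  have h := aC_sum α n
  have hb := aC_bound h0 h1 n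
  have hp := aC_pos h0 h1 n
  constructor
  · refine le_of_mul_le_mul_left (a := α) ?_ h0
    rw [h]; simp only [mul_zero]; positivity
  · rw [← h] at hb
    exact le_of_mul_le_mul_left hb h0

lemma tendsto_pow_neg {α : ℝ} (h0 : 0 < α) :
    Tendsto (fun n : ℕ => ((n:ℝ) + 1) ^ (-α)) atTop (𝓝 0) := by
  have := (tendsto_rpow_neg_atTop h0).comp
    (tendsto_atTop_add_const_right atTop (1:ℝ) tendsto_natCast_atTop_atTop)
  exact this

lemma aC_hasSum {α : ℝ} (h0 : 0 < α) (h1 : α < 1) : HasSum (aC α) 1 := by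
  rw [hasSum_iff_tendsto_nat_of_nonneg (fun n => (aC_pos h0 h1 n).le)]
  have : Tendsto (fun n => 1 - ∑ k ∈ Finset.range n, aC α k) atTop (𝓝 0) :=
    squeeze_zero (fun n => (aC_sum_bound h0 h1 n).1) (fun n => (aC_sum_bound h0 h1 n).2)
      (tendsto_pow_neg h0)
  have := this.const_sub 1
  simpa using this

lemma aC_series {α z : ℝ} (hz : |z| < 1) :
    HasSum (fun n => aC α n * z ^ (n + 1)) (1 - (1 - z) ^ α) := by
  have h := (Real.one_add_rpow_hasFPowerSeriesOnBall_zero (a := α)).hasSum (y := -z)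
    (by
      rw [← ENNReal.ofReal_one, Metric.eball_ofReal]
      simpa using hz)
  simp only [binomialSeries_apply, zero_add, smul_eq_mul] at h
  have h2 := (hasSum_nat_add_iff' 1).2 h
  have h3 := h2.neg
  simp only [List.ofFn_const, List.prod_replicate, Finset.sum_range_one, pow_zero,
    Ring.choose_zero_right, mul_one, ← sub_eq_add_neg, neg_sub] at h3
  have e : (fun n => aC α n * z ^ (n + 1)) = fun b => -(Ring.choose α (b + 1) * (-z) ^ (b + 1)) := by
    ext n
    simp only [aC]
    rw [neg_pow z, pow_succ (-1:ℝ)]; ring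
  rw [e]
  exact h3

lemma aC_HS {α z : ℝ} (hz : |z| < 1) :
    HS (PowerSeries.X * PowerSeries.mk (aC α)) z (1 - (1 - z) ^ α) := by
  unfold HS
  rw [← hasSum_nat_add_iff' 1]
  have := aC_series (α := α) hz
  simpa [PowerSeries.coeff_succ_X_mul] using this

lemma aC_HS_one {α : ℝ} (h0 : 0 < α) (h1 : α < 1) :
    HS (PowerSeries.X * PowerSeries.mk (aC α)) 1 1 := by
  unfold HS
  rw [← hasSum_nat_add_iff' 1]
  have := aC_hasSum h0 h1
  simpa [PowerSeries.coeff_succ_X_mul] using this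

lemma aC_ratio {α : ℝ} (h0 : 0 < α) (h1 : α < 1) (n m : ℕ) :
    aC α (n + 1) * aC α (n + m) ≤ aC α n * aC α (n + m + 1) := by
  have e1 := aC_succ α n
  have e2 := aC_succ α (n + m)
  push_cast at e2
  have p1 := aC_pos h0 h1 n
  have p2 := aC_pos h0 h1 (n + m)
  have hn : (0:ℝ) ≤ n := n.cast_nonneg
  have hm : (0:ℝ) ≤ m := m.cast_nonneg
  have f1 : aC α (n + 1) = (n + 1 - α) / (n + 2) * aC α n := by
    field_simp; linarith
  have f2 : aC α (n + m + 1) = (n + m + 1 - α) / (n + m + 2) * aC α (n + m) := by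
    field_simp; linarith
  rw [f1, f2]
  have : ((n:ℝ) + 1 - α) / (n + 2) ≤ (n + m + 1 - α) / (n + m + 2) := by
    rw [div_le_div_iff₀ (by positivity) (by positivity)]
    nlinarith [mul_nonneg hm h0.le]
  have := mul_le_mul_of_nonneg_right this (mul_pos p1 p2).le
  linarith

lemma aC_anti {α : ℝ} (h0 : 0 < α) (h1 : α < 1) : Antitone (aC α) := by
  apply antitone_nat_of_succ_le
  intro n
  have e1 := aC_succ α n
  have p1 := aC_pos h0 h1 n
  have hn : (0:ℝ) ≤ n := n.cast_nonneg
  nlinarith [mul_pos h0 p1]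

/-- coefficients of the quotient. -/
noncomputable def bC (α ρ : ℝ) (j : ℕ) : ℝ := ∑' m, aC α (j + m) * ρ ^ m

section
variable {α ρ : ℝ} (h0 : 0 < α) (h1 : α < 1) (r0 : 0 < ρ) (r1 : ρ < 1)

lemma bC_summable (h0 : 0 < α) (h1 : α < 1) (r0 : 0 < ρ) (r1 : ρ < 1) (j : ℕ) :
    Summable fun m => aC α (j + m) * ρ ^ m := by
  refine Summable.of_nonneg_of_le (fun m => ?_) (fun m => ?_)
    ((summable_geometric_of_lt_one r0.le r1).mul_left (aC α j))
  · have := aC_pos h0 h1 (j + m); positivity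
  · exact mul_le_mul_of_nonneg_right (aC_anti h0 h1 (by omega)) (by positivity)

lemma bC_le (h0 : 0 < α) (h1 : α < 1) (r0 : 0 < ρ) (r1 : ρ < 1) (j : ℕ) :
    bC α ρ j ≤ aC α j * (1 - ρ)⁻¹ := by
  rw [← tsum_geometric_of_lt_one r0.le r1, ← tsum_mul_left]
  refine (bC_summable h0 h1 r0 r1 j).tsum_le_tsum (fun m => ?_)
    ((summable_geometric_of_lt_one r0.le r1).mul_left (aC α j))
  exact mul_le_mul_of_nonneg_right (aC_anti h0 h1 (by omega)) (by positivity)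

lemma bC_pos (h0 : 0 < α) (h1 : α < 1) (r0 : 0 < ρ) (r1 : ρ < 1) (j : ℕ) : 0 < bC α ρ j := by
  refine (bC_summable h0 h1 r0 r1 j).tsum_pos (fun m => ?_) 0 ?_
  · have := aC_pos h0 h1 (j + m); positivity
  · have := aC_pos h0 h1 (j + 0); positivity

lemma bC_rec (h0 : 0 < α) (h1 : α < 1) (r0 : 0 < ρ) (r1 : ρ < 1) (j : ℕ) :
    bC α ρ j = aC α j + ρ * bC α ρ (j + 1) := by
  unfold bC
  rw [(bC_summable h0 h1 r0 r1 j).tsum_eq_zero_add, ← tsum_mul_left]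
  simp only [add_zero, pow_zero, mul_one]
  congr 1
  refine tsum_congr fun m => ?_
  rw [show j + (m + 1) = j + 1 + m by ring, pow_succ]; ring

lemma bC_ratio_a (h0 : 0 < α) (h1 : α < 1) (r0 : 0 < ρ) (r1 : ρ < 1) (j : ℕ) :
    aC α (j + 1) * bC α ρ (j + 1) ≤ aC α j * bC α ρ (j + 2) := by
  unfold bC
  rw [← tsum_mul_left, ← tsum_mul_left]
  refine ((bC_summable h0 h1 r0 r1 (j+1)).mul_left _).tsum_le_tsum (fun m => ?_)
    ((bC_summable h0 h1 r0 r1 (j+2)).mul_left _)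
  have := aC_ratio h0 h1 j (m + 1)
  rw [show j + 1 + m = j + (m + 1) by ring, show j + 2 + m = j + (m + 1) + 1 by ring]
  have := mul_le_mul_of_nonneg_right this (pow_pos r0 m).le
  linarith

lemma bC_logconvex (h0 : 0 < α) (h1 : α < 1) (r0 : 0 < ρ) (r1 : ρ < 1) (j : ℕ) :
    bC α ρ (j + 1) * bC α ρ (j + 1) ≤ bC α ρ j * bC α ρ (j + 2) := by
  have e1 := bC_rec h0 h1 r0 r1 j
  have e2 := bC_rec h0 h1 r0 r1 (j + 1)
  have := bC_ratio_a h0 h1 r0 r1 j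
  have e3 : bC α ρ (j + 1) * bC α ρ (j + 1) =
      (aC α (j+1) + ρ * bC α ρ (j + 2)) * bC α ρ (j + 1) := by rw [← e2]
  rw [e3, e1]
  linarith
end

lemma logconvex_ratio {b : ℕ → ℝ} (hb : ∀ n, 0 < b n)
    (hl : ∀ n, b (n + 1) * b (n + 1) ≤ b n * b (n + 2)) (j m : ℕ) :
    b (j + 1) * b (j + m) ≤ b j * b (j + m + 1) := by
  have hmono : Monotone fun n => b (n + 1) / b n := by
    apply monotone_nat_of_le_succ
    intro n
    rw [div_le_div_iff₀ (hb _) (hb _)]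
    have := hl n
    rw [show n + 1 + 1 = n + 2 by rfl]
    linarith
  have := hmono (show j ≤ j + m by omega)
  simp only at this
  rw [div_le_div_iff₀ (hb _) (hb _)] at this
  linarith

/-- Theorem of Kaluza. -/
lemma kaluza {b : ℕ → ℝ} (hb : ∀ n, 0 < b n)
    (hl : ∀ n, b (n + 1) * b (n + 1) ≤ b n * b (n + 2)) {g : ℕ → ℝ}
    (hg : PowerSeries.mk g * PowerSeries.mk b = 1) (n : ℕ) :
    g (n + 1) ≤ 0 := by
  have hg0 : g 0 * b 0 = 1 := by
    have := congrArg (PowerSeries.coeff 0) hg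
    simpa [PowerSeries.coeff_mul] using this
  have hgn : ∀ n, ∑ k ∈ Finset.range (n + 1), g (k + 1) * b (n - k) = - (g 0 * b (n + 1)) := by
    intro n
    have := congrArg (PowerSeries.coeff (n + 1)) hg
    rw [PowerSeries.coeff_mul, Finset.Nat.sum_antidiagonal_eq_sum_range_succ_mk,
      Finset.sum_range_succ'] at this
    simp [PowerSeries.coeff_one] at this
    linarith
  induction n using Nat.strong_induction_on with
  | _ n ih =>
  have hgp : 0 < g 0 := by
    have := hb 0
    by_contra h
    nlinarith
  cases n with
  | zero =>
    have := hgn 0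
    simp at this
    have h1 := mul_pos hgp (hb 1)
    have := hb 0
    by_contra h
    push Not at h
    nlinarith [mul_pos h this]
  | succ n =>
    have e1 := hgn n
    have e2 := hgn (n + 1)
    rw [Finset.sum_range_succ] at e2
    simp only [Nat.sub_self] at e2
    have key : b (n + 1) * ∑ k ∈ Finset.range (n + 1), g (k + 1) * b (n + 1 - k) ≥
        b (n + 2) * ∑ k ∈ Finset.range (n + 1), g (k + 1) * b (n - k) := by
      rw [Finset.mul_sum, Finset.mul_sum]
      apply Finset.sum_le_sum
      intro k hk
      have hk' : k < n + 1 := Finset.mem_range.1 hk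
      have h1 := ih k hk'
      have h2 := logconvex_ratio hb hl (n - k) (k + 1)
      rw [show n - k + 1 = n + 1 - k by omega, show n - k + (k + 1) = n + 1 by omega] at h2
      rw [show n + 1 + 1 = n + 2 by rfl] at h2
      nlinarith
    rw [e1] at key
    have e3 : ∑ k ∈ Finset.range (n + 1), g (k + 1) * b (n + 1 - k) =
      - (g 0 * b (n + 2)) - g (n + 2) * b 0 := by
      rw [show n + 1 + 1 = n + 2 by rfl] at e2
      linarith
    rw [e3] at key
    have h3 : 0 ≤ - (b (n + 1) * b 0) * g (n + 2) := by linarith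
    have h4 := mul_pos (hb (n + 1)) (hb 0)
    rw [show n + 1 + 1 = n + 2 by rfl]
    by_contra h
    push Not at h
    nlinarith

lemma kaluza_bound {b : ℕ → ℝ} (hb : ∀ n, 0 < b n)
    (hl : ∀ n, b (n + 1) * b (n + 1) ≤ b n * b (n + 2)) {g : ℕ → ℝ}
    (hg : PowerSeries.mk g * PowerSeries.mk b = 1) (n : ℕ) :
    |g n| ≤ b n / (b 0 * b 0) := by
  have hg0 : g 0 * b 0 = 1 := by
    have := congrArg (PowerSeries.coeff 0) hg
    simpa [PowerSeries.coeff_mul] using this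
  have hb0 := hb 0
  have hg0' : g 0 = 1 / b 0 := by field_simp; linarith
  cases n with
  | zero =>
    rw [hg0', abs_of_pos (by positivity)]
    apply le_of_eq; field_simp
  | succ n =>
    rw [abs_of_nonpos (kaluza hb hl hg n)]
    have := congrArg (PowerSeries.coeff (n + 1)) hg
    rw [PowerSeries.coeff_mul, Finset.Nat.sum_antidiagonal_eq_sum_range_succ_mk,
      Finset.sum_range_succ', Finset.sum_range_succ] at this
    simp [PowerSeries.coeff_one] at this
    have hs : ∑ k ∈ Finset.range n, g (k + 1) * b (n - k) ≤ 0 := by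
      apply Finset.sum_nonpos
      intro k _
      exact mul_nonpos_of_nonpos_of_nonneg (kaluza hb hl hg k) (hb _).le
    rw [le_div_iff₀ (by positivity)]
    have h5 : - g (n + 1) * b 0 ≤ g 0 * b (n + 1) := by linarith
    have := mul_le_mul_of_nonneg_right h5 hb0.le
    calc -g (n + 1) * (b 0 * b 0) = -g (n + 1) * b 0 * b 0 := by ring
      _ ≤ _ := this
      _ = (g 0 * b 0) * b (n + 1) := by ring
      _ = _ := by rw [hg0, one_mul]

open PowerSeries in
lemma factor {α ρ q : ℝ} (h0 : 0 < α) (h1 : α < 1) (r0 : 0 < ρ) (r1 : ρ < 1)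
    (hρ : q * (1 - (1 - ρ) ^ α) = 1) :
    (1 : PowerSeries ℝ) - C q * (X * mk (aC α)) = C q * ((C ρ - X) * mk (bC α ρ)) := by
  have hb0 : ρ * bC α ρ 0 = 1 - (1 - ρ) ^ α := by
    have h := aC_series (α := α) (z := ρ) (by rw [abs_of_pos r0]; exact r1)
    have h2 := (bC_summable h0 h1 r0 r1 0).hasSum.mul_left ρ
    refine h2.unique ?_
    have e : (fun n => ρ * (aC α (0 + n) * ρ ^ n)) = fun n => aC α n * ρ ^ (n + 1) := by
      ext n; rw [zero_add, pow_succ]; ring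
    rw [e]; exact h
  ext n
  cases n with
  | zero =>
    simp [sub_mul]
    rw [hb0, hρ]
  | succ n =>
    simp [sub_mul, coeff_succ_X_mul, coeff_C_mul, coeff_one]
    rw [bC_rec h0 h1 r0 r1 n]; ring

lemma HS_of_le {f : ℕ → ℝ} {c : ℕ → ℝ} (hc : Summable c) (hf : ∀ n, |f n| ≤ c n) {z : ℝ}
    (hz : |z| ≤ 1) : HS (PowerSeries.mk f) z (∑' n, f n * z ^ n) := by
  unfold HS
  simp only [PowerSeries.coeff_mk]
  refine Summable.hasSum (Summable.of_norm_bounded hc fun n => ?_)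
  rw [norm_mul, norm_pow, Real.norm_eq_abs, Real.norm_eq_abs]
  calc |f n| * |z| ^ n ≤ |f n| * 1 :=
        mul_le_mul_of_nonneg_left (pow_le_one₀ (abs_nonneg _) hz) (abs_nonneg _)
    _ ≤ c n := by rw [mul_one]; exact hf n

lemma bC_abs_le {α ρ : ℝ} (h0 : 0 < α) (h1 : α < 1) (r0 : 0 < ρ) (r1 : ρ < 1) (n : ℕ) :
    |bC α ρ n| ≤ aC α n * (1 - ρ)⁻¹ := by
  rw [abs_of_pos (bC_pos h0 h1 r0 r1 n)]
  exact bC_le h0 h1 r0 r1 n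

open PowerSeries in
lemma HS_D {α q z v : ℝ} (h : HS (X * mk (aC α)) z v) :
    HS (1 - C q * (X * mk (aC α))) z (1 - q * v) :=
  (HS_one z).sub ((HS_C q z).mul h)

open PowerSeries in
lemma HS_B {α ρ q z v : ℝ} (h0 : 0 < α) (h1 : α < 1) (r0 : 0 < ρ) (r1 : ρ < 1)
    (hρ : q * (1 - (1 - ρ) ^ α) = 1) (hz : |z| ≤ 1) (h : HS (X * mk (aC α)) z v) :
    q * ((ρ - z) * ∑' n, bC α ρ n * z ^ n) = 1 - q * v := by
  have hB := HS_of_le ((aC_hasSum h0 h1).summable.mul_right (1 - ρ)⁻¹)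
    (bC_abs_le h0 h1 r0 r1) hz
  have h2 := HS_D (q := q) h
  rw [factor h0 h1 r0 r1 hρ] at h2
  exact ((HS_C q z).mul (((HS_C ρ z).sub (HS_X z)).mul hB)).unique h2

lemma bC_at_rho {α ρ q : ℝ} (h0 : 0 < α) (h1 : α < 1) (r0 : 0 < ρ) (r1 : ρ < 1) (hq : 1 < q)
    (hρ : q * (1 - (1 - ρ) ^ α) = 1) :
    ∑' n, bC α ρ n * ρ ^ n = α * (1 - ρ) ^ (α - 1) := by
  set β : ℝ → ℝ := fun z => ∑' n, bC α ρ n * z ^ n with hβ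
  have hcont : ContinuousOn β (Metric.ball 0 1) := by
    refine continuousOn_tsum (fun n => by fun_prop)
      ((aC_hasSum h0 h1).summable.mul_right (1 - ρ)⁻¹) ?_
    intro n z hz
    have hz : |z| < 1 := by simpa using hz
    rw [norm_mul, norm_pow, Real.norm_eq_abs, Real.norm_eq_abs]
    calc |bC α ρ n| * |z| ^ n ≤ |bC α ρ n| * 1 :=
        mul_le_mul_of_nonneg_left (pow_le_one₀ (abs_nonneg _) hz.le) (abs_nonneg _)
      _ ≤ _ := by rw [mul_one]; exact bC_abs_le h0 h1 r0 r1 n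
  have hmem : Metric.ball (0:ℝ) 1 ∈ 𝓝 ρ := by
    apply Metric.isOpen_ball.mem_nhds
    simp [abs_of_pos r0, r1]
  have hc : ContinuousAt β ρ := hcont.continuousAt hmem
  have ht1 : Tendsto β (𝓝[≠] ρ) (𝓝 (β ρ)) := hc.tendsto.mono_left nhdsWithin_le_nhds
  have hd : HasDerivAt (fun z : ℝ => -(1 - z) ^ α) (α * (1 - ρ) ^ (α - 1)) ρ := by
    have h := (((hasDerivAt_id ρ).const_sub 1).rpow_const (p := α)
      (Or.inl (by simp; linarith))).neg
    refine (show HasDerivAt (fun z : ℝ => -(1 - z) ^ α) _ ρ from h).congr_deriv ?_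
    simp
  have ht2 := hasDerivAt_iff_tendsto_slope.1 hd
  refine tendsto_nhds_unique_of_eventuallyEq ht1 ht2 ?_
  have hm2 : Metric.ball (0:ℝ) 1 ∈ 𝓝[≠] ρ := mem_nhdsWithin_of_mem_nhds hmem
  filter_upwards [hm2, self_mem_nhdsWithin] with z hz hne
  have hz : |z| < 1 := by simpa using hz
  have hne : z - ρ ≠ 0 := sub_ne_zero.2 hne
  have h := HS_B h0 h1 r0 r1 hρ hz.le (aC_HS hz)
  have hq0 : q ≠ 0 := by linarith
  rw [slope_def_field, eq_div_iff hne]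
  apply mul_left_cancel₀ hq0
  simp only [hβ]
  linear_combination -h + hρ

open PowerSeries in
lemma main_asymp {α ρ q : ℝ} (h0 : 0 < α) (h1 : α < 1) (r0 : 0 < ρ) (r1 : ρ < 1) (hq : 1 < q)
    (hρ : q * (1 - (1 - ρ) ^ α) = 1) {e : ℕ → ℝ}
    (he : (1 - X) * (1 - C q * (X * mk (aC α))) * mk e = 1) :
    ∃ K, ∀ n : ℕ, |e n - ((1 / (q * α * (1 - ρ) ^ α)) / ρ ^ (n + 1) - 1 / (q - 1))| ≤
      K * ((n:ℝ) + 1) ^ (-α) := by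
  set b := bC α ρ with hbdef
  have hb := bC_pos h0 h1 r0 r1
  have hl := bC_logconvex h0 h1 r0 r1
  have hq0 : q ≠ 0 := by linarith
  have hρ0 : ρ ≠ 0 := r0.ne'
  have hr : 0 < 1 - ρ := by linarith
  set U : PowerSeries ℝ := C q * ((C ρ - X) * mk e) with hU
  set G : PowerSeries ℝ := (1 - X) * U with hG
  set g : ℕ → ℝ := fun n => coeff n G with hgdef
  have hGg : mk g = G := by ext n; simp [hgdef]
  have hgb : mk g * mk b = 1 := by
    rw [hGg, ← he, factor h0 h1 r0 r1 hρ, hG, hU]; ring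
  have hgbound : ∀ n, |g n| ≤ (1 - ρ)⁻¹ / (b 0 * b 0) * aC α n := by
    intro n
    refine (kaluza_bound hb hl hgb n).trans ?_
    have := bC_le h0 h1 r0 r1 n
    have hb0 := hb 0
    calc b n / (b 0 * b 0) ≤ (aC α n * (1 - ρ)⁻¹) / (b 0 * b 0) := by
          exact div_le_div_of_nonneg_right this (by positivity)
      _ = _ := by ring
  set L := (1 - ρ)⁻¹ / (b 0 * b 0) with hL
  have hL0 : 0 ≤ L := by have := hb 0; positivity
  have hasum := aC_hasSum h0 h1
  have hLsum : Summable fun n => L * aC α n := hasum.summable.mul_left L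
  have hgsum : Summable g := Summable.of_norm_bounded hLsum hgbound
  have hbabs := bC_abs_le h0 h1 r0 r1
  have hbs : Summable fun n => aC α n * (1 - ρ)⁻¹ := hasum.summable.mul_right _
  set S := ∑' n, g n with hS
  have hSval : S / (q * (1 - ρ)) = 1 / (q - 1) := by
    have hB1 := HS_B h0 h1 r0 r1 hρ (by simp) (aC_HS_one h0 h1)
    have hg1 := (HS_of_le hLsum hgbound (z := 1) (by simp)).mul
      (HS_of_le hbs hbabs (z := 1) (by simp))
    rw [hgb] at hg1
    have := hg1.unique (HS_one 1)
    simp only [one_pow, mul_one] at this hB1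
    have hq1 : q - 1 ≠ 0 := by linarith
    rw [div_eq_div_iff (by positivity) hq1]
    have h3 : q - 1 = q * (1 - ρ) * ∑' n, bC α ρ n := by linear_combination hB1
    rw [h3]
    linear_combination q * (1 - ρ) * this
  -- partial sums
  set s : ℕ → ℝ := fun n => ∑ k ∈ Finset.range (n + 1), g k with hs
  have hUs : ∀ n, coeff n U = s n := by
    intro n
    induction n with
    | zero =>
      simp [hs, hgdef, hG, sub_mul]
    | succ n ih =>
      have : s (n + 1) = s n + g (n + 1) := Finset.sum_range_succ _ _
      rw [this, ← ih]
      simp [hgdef, hG, sub_mul, coeff_succ_X_mul]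
  have hUe0 : s 0 = q * (ρ * e 0) := by
    rw [← hUs]; simp [hU, sub_mul]
  have hUe : ∀ n, s (n + 1) = q * (ρ * e (n + 1) - e n) := by
    intro n
    rw [← hUs]; simp [hU, sub_mul, coeff_succ_X_mul, coeff_C_mul]
  -- tails
  have htail : ∀ n, |S - s n| ≤ L * ((n:ℝ) + 1) ^ (-α) := by
    intro n
    have h2 := hgsum.sum_add_tsum_nat_add (n + 1)
    have h3 : S - s n = ∑' k, g (k + (n + 1)) := by rw [hS, hs, ← h2]; ring
    have h4 := hasum.summable.sum_add_tsum_nat_add (n + 1)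
    rw [hasum.tsum_eq] at h4
    have h5 : ‖∑' k, g (k + (n + 1))‖ ≤ L * ∑' k, aC α (k + (n + 1)) := by
      refine tsum_of_norm_bounded ?_ (fun k => hgbound (k + (n + 1)))
      exact (((summable_nat_add_iff (n + 1)).2 hasum.summable).hasSum).mul_left L
    rw [h3, ← Real.norm_eq_abs]
    refine h5.trans (mul_le_mul_of_nonneg_left ?_ hL0)
    have h6 := (aC_sum_bound h0 h1 (n + 1)).2
    have h7 : ((((n + 1 : ℕ)):ℝ) + 1) ^ (-α) ≤ ((n:ℝ) + 1) ^ (-α) := by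
      apply Real.rpow_le_rpow_of_nonpos (by positivity) _ (by linarith)
      push_cast; linarith
    linarith
  have hpow1 : ∀ n : ℕ, ((n:ℝ) + 1) ^ (-α) ≤ 1 := by
    intro n
    apply Real.rpow_le_one_of_one_le_of_nonpos _ (by linarith)
    have : (0:ℝ) ≤ n := n.cast_nonneg
    linarith
  have hgeo := summable_geometric_of_lt_one r0.le r1
  have hsb : ∀ n, |s n| ≤ |S| + L := by
    intro n
    have h2 := htail n
    have h3 : L * ((n:ℝ) + 1) ^ (-α) ≤ L := by
      have := mul_le_mul_of_nonneg_left (hpow1 n) hL0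
      linarith
    have h4 : |s n| ≤ |S| + |S - s n| := by
      have := abs_sub S (S - s n)
      simpa using this
    linarith
  have hssum : ∀ n, Summable fun m => s (n + m) * ρ ^ m := by
    intro n
    refine Summable.of_norm_bounded (hgeo.mul_left (|S| + L)) fun m => ?_
    rw [norm_mul, norm_pow, Real.norm_eq_abs, Real.norm_eq_abs, abs_of_pos r0]
    exact mul_le_mul_of_nonneg_right (hsb _) (by positivity)
  set x : ℕ → ℝ := fun n => ∑' m, s (n + m) * ρ ^ m with hx
  have hxrec : ∀ n, x n = s n + ρ * x (n + 1) := by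
    intro n
    simp only [hx]
    rw [(hssum n).tsum_eq_zero_add, ← tsum_mul_left]
    simp only [add_zero, pow_zero, mul_one]
    congr 1
    refine tsum_congr fun m => ?_
    rw [show n + (m + 1) = n + 1 + m by ring, pow_succ]; ring
  have hsol : ∀ n, q * e n * ρ ^ (n + 1) = x 0 - x (n + 1) * ρ ^ (n + 1) := by
    intro n
    induction n with
    | zero =>
      rw [hxrec 0, hUe0]; ring
    | succ n ih =>
      have h2 := hxrec (n + 1)
      have h3 := hUe n
      rw [h2, h3] at ih
      rw [pow_succ ρ (n + 1)]
      linear_combination ih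
  have hx0 : x 0 = 1 / (α * (1 - ρ) ^ α) := by
    have hHU : HS U ρ (x 0) := by
      unfold HS
      simp only [hUs]
      have h := (hssum 0).hasSum
      simp only [hx]
      simpa only [zero_add] using h
    have h2 := ((HS_one ρ).sub (HS_X ρ)).mul hHU
    rw [← hG, ← hGg] at h2
    have h3 := h2.mul (HS_of_le hbs hbabs (z := ρ) (by rw [abs_of_pos r0]; exact r1.le))
    rw [hgb, bC_at_rho h0 h1 r0 r1 hq hρ] at h3
    have h4 := h3.unique (HS_one ρ)
    rw [Real.rpow_sub_one hr.ne'] at h4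
    have h5 : 0 < (1 - ρ) ^ α := by positivity
    rw [eq_div_iff (by positivity)]
    have h6 : (1 - ρ) * ((1 - ρ) ^ α / (1 - ρ)) = (1 - ρ) ^ α := mul_div_cancel₀ _ hr.ne'
    linear_combination h4 - x 0 * α * h6
  have hxn : ∀ n, |x n - S * (1 - ρ)⁻¹| ≤ L * ((n:ℝ) + 1) ^ (-α) * (1 - ρ)⁻¹ := by
    intro n
    have hg2 := (hasSum_geometric_of_lt_one r0.le r1)
    have h2 := ((hssum n).hasSum.sub (hg2.mul_left S))
    have h3 : x n - S * (1 - ρ)⁻¹ = ∑' m, (s (n + m) * ρ ^ m - S * ρ ^ m) := h2.tsum_eq.symm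
    rw [h3, ← Real.norm_eq_abs]
    refine tsum_of_norm_bounded (hg2.mul_left _) fun m => ?_
    rw [← sub_mul, norm_mul, norm_pow, Real.norm_eq_abs, Real.norm_eq_abs, abs_of_pos r0,
      abs_sub_comm]
    apply mul_le_mul_of_nonneg_right _ (by positivity)
    refine (htail (n + m)).trans (mul_le_mul_of_nonneg_left ?_ hL0)
    apply Real.rpow_le_rpow_of_nonpos (by positivity) _ (by linarith)
    push_cast
    have : (0:ℝ) ≤ m := m.cast_nonneg
    linarith
  refine ⟨L * (1 - ρ)⁻¹ / q, fun n => ?_⟩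
  have e1 : e n - ((1 / (q * α * (1 - ρ) ^ α)) / ρ ^ (n + 1) - 1 / (q - 1)) =
      -(x (n + 1) - S * (1 - ρ)⁻¹) / q := by
    rw [← hSval]
    have h2 := hsol n
    have h3 : 1 / (q * α * (1 - ρ) ^ α) = x 0 / q := by
      rw [hx0]; rw [div_div]; ring_nf
    rw [h3]
    have h4 : e n = (x 0 - x (n + 1) * ρ ^ (n + 1)) / (q * ρ ^ (n + 1)) := by
      rw [← h2]; field_simp
    rw [h4]
    field_simp
    ring
  have hqp : 0 < q := by linarith
  rw [e1, abs_div, abs_neg, abs_of_pos hqp, div_mul_eq_mul_div]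
  apply div_le_div_of_nonneg_right _ hqp.le
  refine (hxn (n + 1)).trans ?_
  rw [mul_right_comm]
  apply mul_le_mul_of_nonneg_left _ (by positivity)
  apply Real.rpow_le_rpow_of_nonpos (by positivity) _ (by linarith)
  push_cast; linarith

open Real Filter Topology Set Asymptotics

/-- For `1/2 < p < 1`, with `ρ_p = 1 - (p/(1-p))^{1/(1-2p)} ∈ (0,1)`, the coefficients
`E_n = [z^{n-1}] (1-2p)/((1-p)(1-z) - p(1-z)^{2p})` satisfy
`E_n = ρ_p^{-n}/(1-p) - (2p-1)/(1-p) + O(n^{1-2p})`. -/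
theorem stmt7 (p : ℝ) (hp : 1 / 2 < p) (hp1 : p < 1) :
    (1 - (p / (1 - p)) ^ (1 / (1 - 2 * p))) ∈ Ioo (0 : ℝ) 1 ∧
    ∀ E : ℕ → ℝ,
      (∀ z : ℝ, |z| < 1 - (p / (1 - p)) ^ (1 / (1 - 2 * p)) →
        ∑' n : ℕ, E (n + 1) * z ^ n =
          (1 - 2 * p) / ((1 - p) * (1 - z) - p * (1 - z) ^ (2 * p))) →
      (fun n : ℕ => E n -
          ((1 / (1 - p)) / (1 - (p / (1 - p)) ^ (1 / (1 - 2 * p))) ^ n -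
            (2 * p - 1) / (1 - p)))
        =O[atTop] (fun n : ℕ => (n : ℝ) ^ (1 - 2 * p)) := by
  have hp0 : 0 < p := by linarith
  have h1p : 0 < 1 - p := by linarith
  have hα0 : 0 < 2 * p - 1 := by linarith
  have hα1 : 2 * p - 1 < 1 := by linarith
  have hbase : 1 < p / (1 - p) := by rw [lt_div_iff₀ h1p]; linarith
  have hw0 : 0 < (p / (1 - p)) ^ (1 / (1 - 2 * p)) := by positivity
  have hw1 : (p / (1 - p)) ^ (1 / (1 - 2 * p)) < 1 := by
    apply Real.rpow_lt_one_of_one_lt_of_neg hbase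
    exact div_neg_of_pos_of_neg one_pos (by linarith)
  have hwα : ((p / (1 - p)) ^ (1 / (1 - 2 * p))) ^ (2 * p - 1) = (1 - p) / p := by
    rw [← Real.rpow_mul (by positivity)]
    have hne : 1 - 2 * p ≠ 0 := by linarith
    have : 1 / (1 - 2 * p) * (2 * p - 1) = -1 := by field_simp; ring
    rw [this, Real.rpow_neg_one, inv_div]
  generalize (p / (1 - p)) ^ (1 / (1 - 2 * p)) = w at *
  refine ⟨⟨by linarith, by linarith⟩, fun E hE => ?_⟩
  obtain ⟨ρ, hρdef⟩ : ∃ ρ, ρ = 1 - w := ⟨_, rfl⟩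
  have hw : 1 - ρ = w := by rw [hρdef]; ring
  rw [← hρdef] at hE ⊢
  have r0 : 0 < ρ := by linarith
  have r1 : ρ < 1 := by linarith
  obtain ⟨α, hα⟩ : ∃ α, α = 2 * p - 1 := ⟨_, rfl⟩
  obtain ⟨q, hqdef⟩ : ∃ q, q = p / (2 * p - 1) := ⟨_, rfl⟩
  have hq : 1 < q := by rw [hqdef, lt_div_iff₀ hα0]; linarith
  have hqα : q * (2 * p - 1) = p := by rw [hqdef, div_mul_cancel₀ _ hα0.ne']
  have hρα : (1 - ρ) ^ α = (1 - p) / p := by rw [hw, hα, hwα]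
  have hρq : q * (1 - (1 - ρ) ^ α) = 1 := by
    have h2 : (1:ℝ) - (1 - p) / p = (2 * p - 1) / p := by field_simp; ring
    rw [hρα, h2, mul_div_assoc', hqα, div_self hp0.ne']
  have hid : (1 - PowerSeries.X) *
      (1 - PowerSeries.C q * (PowerSeries.X * PowerSeries.mk (aC α))) *
      PowerSeries.mk (fun n => E (n + 1)) = 1 := by
    apply HS.eq_one r0
    intro z hz
    have hz1 : |z| < 1 := hz.trans r1
    have hzp : 0 < 1 - z := by have := (abs_lt.1 hz1).2; linarith
    have hgt : (1 - p) / p < (1 - z) ^ α := by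
      rw [← hρα]
      apply Real.rpow_lt_rpow (by linarith) _ (by linarith)
      have := (abs_lt.1 hz).2; linarith
    have h2p : (1 - z) ^ (2 * p) = (1 - z) * (1 - z) ^ α := by
      rw [show 2 * p = 1 + α by rw [hα]; ring, Real.rpow_add hzp, Real.rpow_one]
    have hden : (1 - p) * (1 - z) - p * (1 - z) ^ (2 * p) =
        (1 - 2 * p) * ((1 - z) * (1 - q * (1 - (1 - z) ^ α))) := by
      rw [h2p]
      linear_combination (-1) * (1 - z) * (1 - (1 - z) ^ α) * hqα
    have hne : (1 - z) * (1 - q * (1 - (1 - z) ^ α)) ≠ 0 := by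
      apply mul_ne_zero hzp.ne'
      have : q * (1 - (1 - z) ^ α) < 1 := by
        rw [hρα] at hρq
        refine lt_of_lt_of_eq ?_ hρq
        apply mul_lt_mul_of_pos_left _ (by linarith)
        linarith
      linarith
    have h12 : 1 - 2 * p ≠ 0 := by linarith
    have hv := hE z hz
    rw [hden, div_mul_eq_div_div, div_self h12] at hv
    have hsum : Summable fun n => E (n + 1) * z ^ n := by
      by_contra h
      rw [tsum_eq_zero_of_not_summable h] at hv
      exact (one_div_ne_zero hne) hv.symm
    have hHE : HS (PowerSeries.mk fun n => E (n + 1)) z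
        (1 / ((1 - z) * (1 - q * (1 - (1 - z) ^ α)))) := by
      unfold HS
      simp only [PowerSeries.coeff_mk]
      rw [← hv]; exact hsum.hasSum
    have h3 := (((HS_one z).sub (HS_X z)).mul (HS_D (q := q) (aC_HS (α := α) hz1))).mul hHE
    rwa [mul_one_div_cancel hne] at h3
  obtain ⟨K, hK⟩ := main_asymp (by rw [hα]; exact hα0) (by rw [hα]; exact hα1) r0 r1 hq hρq hid
  have c1 : q * α * (1 - ρ) ^ α = 1 - p := by
    rw [hα, hqα, ← hα, hρα]; field_simp
  have c2 : 1 / (q - 1) = (2 * p - 1) / (1 - p) := by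
    have : q - 1 ≠ 0 := by linarith
    rw [div_eq_div_iff this h1p.ne']
    linear_combination -hqα
  rw [c1, c2] at hK
  refine IsBigO.of_bound K ?_
  filter_upwards [eventually_ge_atTop 1] with n hn
  obtain ⟨m, rfl⟩ : ∃ m, n = m + 1 := ⟨n - 1, by omega⟩
  have h := hK m
  have hnn : (0:ℝ) ≤ ((m:ℝ) + 1) ^ (-α) := by positivity
  rw [Real.norm_eq_abs, Real.norm_eq_abs]
  push_cast
  rw [show 1 - 2 * p = -α by rw [hα]; ring, abs_of_nonneg hnn]
  exact h
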